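/- Let a and b be relatively prime positive integers with a/b < 1, let k ≥ 2 be an integer, and let q ≥ 2 be an integer satisfying q > 2·log b / (log b − log a). Let ℓ ≥ 1 and 0 ≤ h ≤ q^ℓ − 1 be integers and set ω = exp(2πih/q^ℓ). Then the complex number V_{q,k}(ω·a/b) = ∑_{n≥1} (ν_q(n) mod k)·(ω·a/b)^n is transcendental over ℚ. -/

import Mathlib

noncomputable def vv (q k n : ℕ) : ℕ := padicValNat q n % k

noncomputable def VV (q k : ℕ) (x : ℂ) : ℂ := ∑' n : ℕ, ((vv q k n : ℕ) : ℂ) * x ^ n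

lemma vv_zero (q k : ℕ) : vv q k 0 = 0 := by simp [vv]

lemma vv_le (q k n : ℕ) (hk : 2 ≤ k) : vv q k n ≤ k := (Nat.mod_lt _ (by omega)).le

lemma vv_not_dvd (q k n : ℕ) (h : ¬ q ∣ n) : vv q k n = 0 := by
  simp [vv, padicValNat.eq_zero_of_not_dvd h]

lemma pv_unique {q n e : ℕ} (hq : 2 ≤ q) (hn : n ≠ 0) (h1 : q ^ e ∣ n) (h2 : ¬ q ^ (e + 1) ∣ n) :
    padicValNat q n = e := by
  rw [padicValNat_dvd_iff_le_of_ne_one (by omega) hn] at h1 h2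
  omega

lemma pv_spec {q n : ℕ} (hq : 2 ≤ q) (hn : n ≠ 0) :
    q ^ padicValNat q n ∣ n ∧ ¬ q ^ (padicValNat q n + 1) ∣ n := by
  rw [padicValNat_dvd_iff_le_of_ne_one (by omega) hn,
    padicValNat_dvd_iff_le_of_ne_one (by omega) hn]
  omega

lemma vv_mul (q k n : ℕ) (hq : 2 ≤ q) : vv q k (q ^ k * n) = vv q k n := by
  rcases Nat.eq_zero_or_pos n with rfl | hn
  · simp
  have h := pv_spec hq hn.ne'
  have hqk : 0 < q ^ k := by positivity
  have : padicValNat q (q ^ k * n) = k + padicValNat q n := by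
    apply pv_unique hq (by positivity)
    · rw [pow_add]; exact Nat.mul_dvd_mul_left _ h.1
    · rw [add_assoc, pow_add, Nat.mul_dvd_mul_iff_left hqk]; exact h.2
  simp [vv, this]

lemma vv_add (q k t u : ℕ) (hq : 2 ≤ q) (ht : 0 < t) (htd : t < q ^ k) :
    vv q k (t + q ^ k * u) = vv q k t := by
  have h := pv_spec hq ht.ne'
  have hlt : padicValNat q t < k := by
    have h1 : q ^ padicValNat q t < q ^ k := (Nat.le_of_dvd ht h.1).trans_lt htd
    exact (Nat.pow_lt_pow_iff_right (by omega)).1 h1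
  have : padicValNat q (t + q ^ k * u) = padicValNat q t := by
    apply pv_unique hq (by omega)
    · exact dvd_add h.1 (Dvd.dvd.mul_right (pow_dvd_pow _ hlt.le) _)
    · intro h3
      exact h.2 ((Nat.dvd_add_left (Dvd.dvd.mul_right (pow_dvd_pow _ hlt) _)).1 h3)
  simp [vv, this]

lemma vv_one (q k j : ℕ) (hq : 2 ≤ q) (hk : 2 ≤ k) : vv q k (q * (q * j + 1)) = 1 := by
  have : padicValNat q (q * (q * j + 1)) = 1 := by
    apply pv_unique hq (by positivity)
    · simp
    · rw [pow_succ, pow_one, Nat.mul_dvd_mul_iff_left (by omega)]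
      intro h
      have := (Nat.dvd_add_right (Dvd.intro j rfl)).1 h
      have := Nat.le_of_dvd one_pos this
      omega
  rw [vv, this, Nat.mod_eq_of_lt hk]

lemma vv_summable (q k : ℕ) (hk : 2 ≤ k) (x : ℂ) (hx : ‖x‖ < 1) :
    Summable fun n : ℕ => ‖((vv q k n : ℕ) : ℂ) * x ^ n‖ := by
  refine Summable.of_nonneg_of_le (fun _ => norm_nonneg _) (fun n => ?_)
    ((summable_geometric_of_lt_one (norm_nonneg x) hx).mul_left (k : ℝ))
  rw [norm_mul, norm_pow, Complex.norm_natCast]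
  gcongr
  exact vv_le q k n hk

lemma VV_hasSum (q k : ℕ) (hk : 2 ≤ k) (x : ℂ) (hx : ‖x‖ < 1) :
    HasSum (fun n : ℕ => ((vv q k n : ℕ) : ℂ) * x ^ n) (VV q k x) :=
  (vv_summable q k hk x hx).of_norm.hasSum

lemma VV_bound (q k : ℕ) (hk : 2 ≤ k) (x : ℂ) (ρ : ℝ) (hx : ‖x‖ ≤ ρ) (hρ : ρ < 1) :
    ‖VV q k x‖ ≤ k * (1 - ρ)⁻¹ := by
  have h0 : 0 ≤ ρ := (norm_nonneg x).trans hx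
  refine tsum_of_norm_bounded ((hasSum_geometric_of_lt_one h0 hρ).mul_left (k : ℝ)) (fun n => ?_)
  rw [norm_mul, norm_pow, Complex.norm_natCast]
  gcongr
  exact vv_le q k n hk

noncomputable def SS (q k : ℕ) (x : ℂ) : ℂ := ∑ t ∈ Finset.range (q ^ k), ((vv q k t : ℕ) : ℂ) * x ^ t

noncomputable def RR (q k : ℕ) (x : ℂ) : ℂ := SS q k x / (1 - x ^ (q ^ k))

lemma VV_step (q k : ℕ) (hq : 2 ≤ q) (hk : 2 ≤ k) (x : ℂ) (hx : ‖x‖ < 1) :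
    VV q k x = RR q k x + VV q k (x ^ (q ^ k)) := by
  have hd : 0 < q ^ k := by positivity
  have hxd : ‖x ^ (q ^ k)‖ < 1 := by
    rw [norm_pow]; exact pow_lt_one₀ (norm_nonneg _) hx hd.ne'
  obtain ⟨D, hD⟩ : ∃ D, q ^ k = D + 1 := ⟨q ^ k - 1, by omega⟩
  have h1 := Nat.sumByResidueClasses (vv_summable q k hk x hx).of_norm (D + 1)
  have h2 : ∀ j : Fin (D + 1), ∑' m : ℕ, ((vv q k (j.val + (D + 1) * m) : ℕ) : ℂ) *
      x ^ (j.val + (D + 1) * m) = (vv q k j.val : ℂ) * x ^ j.val * (1 - x ^ (D + 1))⁻¹ +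
        if j.val = 0 then VV q k (x ^ (D + 1)) else 0 := by
    intro j
    split_ifs with h
    · rw [h, vv_zero]
      simp only [zero_add, Nat.cast_zero, zero_mul, VV]
      refine tsum_congr fun m => ?_
      rw [← hD, vv_mul q k m hq, pow_mul]
    · rw [add_zero, ← tsum_geometric_of_norm_lt_one (hD ▸ hxd), ← tsum_mul_left]
      refine tsum_congr fun m => ?_
      have h5 := vv_add q k j.val m hq (by omega) (by omega)
      rw [hD] at h5
      rw [h5, pow_add, ← pow_mul]
      ring
  have h3 : VV q k x = ∑ j : Fin (D + 1), ((vv q k j.val : ℂ) * x ^ j.val * (1 - x ^ (D + 1))⁻¹ +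
        if j.val = 0 then VV q k (x ^ (D + 1)) else 0) := by
    rw [← Finset.sum_congr rfl (fun j _ => h2 j)]
    exact h1
  rw [h3, Finset.sum_add_distrib, ← Finset.sum_mul, RR, SS, hD, div_eq_mul_inv,
    Fin.sum_univ_eq_sum_range (fun j => (vv q k j : ℂ) * x ^ j) (D + 1)]
  congr 1
  rw [Fin.sum_univ_succ]
  simp

lemma VV_iter (q k : ℕ) (hq : 2 ≤ q) (hk : 2 ≤ k) (x : ℂ) (hx : ‖x‖ < 1) (m : ℕ) :
    VV q k x = (∑ i ∈ Finset.range m, RR q k (x ^ (q ^ k) ^ i)) + VV q k (x ^ (q ^ k) ^ m) := by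
  induction m with
  | zero => simp
  | succ m ih =>
    rw [ih, Finset.sum_range_succ, VV_step q k hq hk (x ^ (q ^ k) ^ m), ← pow_mul x,
      ← pow_succ (q ^ k)]
    · ring
    · rw [norm_pow]; exact pow_lt_one₀ (norm_nonneg _) hx (by positivity)

lemma VV_large (q k : ℕ) (hq : 2 ≤ q) (hk : 2 ≤ k) (A : ℝ) :
    ∃ ε < (1 : ℝ), ∀ r : ℝ, ε < r → 0 ≤ r → r < 1 → A < ‖VV q k (r : ℂ)‖ := by
  obtain ⟨M, hM⟩ := exists_nat_gt A
  have hc : Filter.Tendsto (fun r : ℝ => ∑ j ∈ Finset.range M, r ^ (q * (q * j + 1)))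
      (nhds 1) (nhds (M : ℝ)) := by
    have : Continuous (fun r : ℝ => ∑ j ∈ Finset.range M, r ^ (q * (q * j + 1))) := by fun_prop
    simpa using this.tendsto 1
  have h1 := hc.eventually (lt_mem_nhds hM)
  obtain ⟨δ, hδ, h2⟩ := Metric.eventually_nhds_iff.1 h1
  refine ⟨1 - δ, by linarith, fun r hr h0 hr1 => ?_⟩
  have h3 := h2 (y := r) (by rw [Real.dist_eq, abs_lt]; constructor <;> linarith)
  have hs : Summable fun n : ℕ => (vv q k n : ℝ) * r ^ n := by
    have := vv_summable q k hk (r : ℂ) (by simpa [abs_of_nonneg h0] using hr1)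
    refine this.congr fun n => ?_
    simp [abs_of_nonneg h0]
  have h4 : VV q k (r : ℂ) = ((∑' n : ℕ, (vv q k n : ℝ) * r ^ n : ℝ) : ℂ) := by
    rw [VV, Complex.ofReal_tsum]; simp
  rw [h4, Complex.norm_real]
  refine h3.trans_le (le_trans ?_ (le_abs_self _))
  have hinj : Function.Injective (fun j : ℕ => q * (q * j + 1)) := by
    intro i j h
    have h5 : q * i + 1 = q * j + 1 := Nat.eq_of_mul_eq_mul_left (by omega) h
    exact Nat.eq_of_mul_eq_mul_left (by omega) (Nat.add_right_cancel h5)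
  have h6 := hs.sum_le_tsum ((Finset.range M).map ⟨_, hinj⟩) (fun n _ => by positivity)
  rw [Finset.sum_map] at h6
  refine le_trans (le_of_eq ?_) h6
  refine Finset.sum_congr rfl fun j _ => ?_
  simp [vv_one q k j hq hk]

lemma VV_rot (q k : ℕ) (x ζ : ℂ) (hζ : ζ ^ q = 1) : VV q k (ζ * x) = VV q k x := by
  refine tsum_congr fun n => ?_
  by_cases h : q ∣ n
  · obtain ⟨c, rfl⟩ := h
    rw [mul_pow, pow_mul ζ, hζ, one_pow, one_mul]
  · simp [vv_not_dvd q k n h]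

lemma VV_tendsto (q k : ℕ) (hq : 2 ≤ q) (hk : 2 ≤ k) :
    Filter.Tendsto (fun r : ℝ => ‖VV q k (r : ℂ)‖) (nhdsWithin 1 (Set.Iio 1)) Filter.atTop := by
  rw [Filter.tendsto_atTop]
  intro A
  obtain ⟨ε, hε, h⟩ := VV_large q k hq hk A
  have h1 : ∀ᶠ r : ℝ in nhdsWithin 1 (Set.Iio 1), ε < r :=
    (lt_mem_nhds hε).filter_mono nhdsWithin_le_nhds
  have h2 : ∀ᶠ r : ℝ in nhdsWithin 1 (Set.Iio 1), 0 < r :=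
    (lt_mem_nhds one_pos).filter_mono nhdsWithin_le_nhds
  filter_upwards [h1, h2, self_mem_nhdsWithin] with r h3 h4 h5
  exact (h r h3 h4.le h5).le

lemma VV_zeta (q k : ℕ) (hq : 2 ≤ q) (hk : 2 ≤ k) (m : ℕ) (ζ : ℂ)
    (hζ : IsPrimitiveRoot ζ ((q ^ k) ^ m * q)) :
    Filter.Tendsto (fun r : ℝ => ‖VV q k (r * ζ)‖) (nhdsWithin 1 (Set.Iio 1)) Filter.atTop := by
  have hd : 2 ≤ q ^ k := hq.trans (Nat.le_self_pow (by omega) q)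
  have hnorm : ‖ζ‖ = 1 := hζ.norm'_eq_one (by positivity)
  set s := (q ^ k) ^ m with hs
  have hspos : 0 < s := by positivity
  -- the finite part
  have hF : Filter.Tendsto (fun r : ℝ => ∑ i ∈ Finset.range m, RR q k ((r * ζ) ^ (q ^ k) ^ i))
      (nhdsWithin 1 (Set.Iio 1)) (nhds (∑ i ∈ Finset.range m, RR q k (((1 : ℝ) * ζ) ^ (q ^ k) ^ i))) := by
    refine tendsto_finsetSum _ fun i hi => ?_
    have hne : (1 : ℂ) - ((((1 : ℝ) : ℂ) * ζ) ^ (q ^ k) ^ i) ^ (q ^ k) ≠ 0 := by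
      rw [Complex.ofReal_one, one_mul, ← pow_mul, ← pow_succ]
      intro h0
      have h1 : ζ ^ (q ^ k) ^ (i + 1) = 1 := (sub_eq_zero.1 h0).symm
      have h2 := Nat.le_of_dvd (by positivity) (hζ.dvd_of_pow_eq_one _ h1)
      have h3 : (q ^ k) ^ (i + 1) ≤ s :=
        Nat.pow_le_pow_right (by omega) (Finset.mem_range.1 hi)
      nlinarith
    have : ContinuousAt (fun r : ℝ => RR q k ((r * ζ) ^ (q ^ k) ^ i)) 1 := by
      unfold RR SS
      refine ContinuousAt.div ?_ ?_ hne
      · fun_prop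
      · fun_prop
    exact this.tendsto.mono_left nhdsWithin_le_nhds
  have hpow : Filter.Tendsto (fun r : ℝ => r ^ s) (nhdsWithin 1 (Set.Iio 1))
      (nhdsWithin 1 (Set.Iio 1)) := by
    refine tendsto_nhdsWithin_iff.2 ⟨?_, ?_⟩
    · have : Continuous (fun r : ℝ => r ^ s) := by fun_prop
      simpa using (this.tendsto 1).mono_left (nhdsWithin_le_nhds (s := Set.Iio 1))
    · have h2 : ∀ᶠ r : ℝ in nhdsWithin 1 (Set.Iio 1), 0 < r :=
        (lt_mem_nhds one_pos).filter_mono nhdsWithin_le_nhds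
      filter_upwards [h2, self_mem_nhdsWithin] with r h3 h4
      exact pow_lt_one₀ h3.le h4 hspos.ne'
  have hbig := (VV_tendsto q k hq hk).comp hpow
  have hsum := Filter.tendsto_atTop_add_const_right _
    (-(‖∑ i ∈ Finset.range m, RR q k (((1 : ℝ) * ζ) ^ (q ^ k) ^ i)‖ + 1)) hbig
  refine Filter.tendsto_atTop_mono' _ ?_ hsum
  have hFb : ∀ᶠ r : ℝ in nhdsWithin 1 (Set.Iio 1),
      ‖∑ i ∈ Finset.range m, RR q k ((r * ζ) ^ (q ^ k) ^ i)‖ <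
      ‖∑ i ∈ Finset.range m, RR q k (((1 : ℝ) * ζ) ^ (q ^ k) ^ i)‖ + 1 :=
    hF.norm.eventually (gt_mem_nhds (lt_add_one _))
  have h2 : ∀ᶠ r : ℝ in nhdsWithin 1 (Set.Iio 1), 0 < r :=
    (lt_mem_nhds one_pos).filter_mono nhdsWithin_le_nhds
  filter_upwards [hFb, h2, self_mem_nhdsWithin] with r h3 h4 h5
  have h6 : ‖(r : ℂ) * ζ‖ < 1 := by
    rw [norm_mul, hnorm, mul_one, Complex.norm_real, Real.norm_eq_abs, abs_of_pos h4]
    exact h5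
  have h7 := VV_iter q k hq hk _ h6 m
  rw [← hs, mul_pow, mul_comm ((r : ℂ) ^ s), VV_rot q k _ (ζ ^ s) (by
    rw [← pow_mul]; exact hζ.pow_eq_one)] at h7
  have h8 : VV q k ((r : ℂ) ^ s) = VV q k (r * ζ) -
    ∑ i ∈ Finset.range m, RR q k ((r * ζ) ^ (q ^ k) ^ i) := by rw [h7]; ring
  have h9 := norm_sub_le (VV q k (r * ζ)) (∑ i ∈ Finset.range m, RR q k ((r * ζ) ^ (q ^ k) ^ i))
  rw [← h8] at h9
  simp only [Function.comp_apply, Complex.ofReal_pow]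
  linarith

lemma lead_zero (q k : ℕ) (hq : 2 ≤ q) (hk : 2 ≤ k) (A : ℕ → Polynomial ℂ) (J : ℕ)
    (h : ∀ x : ℂ, ‖x‖ < 1 → ∑ j ∈ Finset.range (J + 1), (A j).eval x * VV q k x ^ j = 0) :
    A J = 0 := by
  have hd : 2 ≤ q ^ k := hq.trans (Nat.le_self_pow (by omega) q)
  have key : ∀ m : ℕ, ∀ ζ : ℂ, IsPrimitiveRoot ζ ((q ^ k) ^ m * q) → (A J).IsRoot ζ := by
    intro m ζ hζ
    have hnorm : ‖ζ‖ = 1 := hζ.norm'_eq_one (by positivity)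
    have ht := VV_zeta q k hq hk m ζ hζ
    have hinv : Filter.Tendsto (fun r : ℝ => (VV q k (r * ζ))⁻¹) (nhdsWithin 1 (Set.Iio 1))
        (nhds 0) := by
      rw [tendsto_zero_iff_norm_tendsto_zero]
      simp only [norm_inv]
      exact ht.inv_tendsto_atTop
    have hA : ∀ j, Filter.Tendsto (fun r : ℝ => (A j).eval ((r : ℂ) * ζ))
        (nhdsWithin 1 (Set.Iio 1)) (nhds ((A j).eval ζ)) := by
      intro j
      have : Continuous (fun r : ℝ => (A j).eval ((r : ℂ) * ζ)) :=
        (A j).continuous.comp (by fun_prop)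
      simpa using (this.tendsto 1).mono_left (nhdsWithin_le_nhds (s := Set.Iio 1))
    have hlim : Filter.Tendsto (fun r : ℝ => - ∑ j ∈ Finset.range J, (A j).eval ((r : ℂ) * ζ) *
        (VV q k (r * ζ))⁻¹ ^ (J - j)) (nhdsWithin 1 (Set.Iio 1))
        (nhds (- ∑ j ∈ Finset.range J, (A j).eval ζ * 0 ^ (J - j))) := by
      refine (tendsto_finsetSum _ fun j _ => ?_).neg
      exact (hA j).mul (hinv.pow _)
    have h0 : (- ∑ j ∈ Finset.range J, (A j).eval ζ * 0 ^ (J - j)) = 0 := by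
      rw [Finset.sum_eq_zero, neg_zero]
      intro j hj
      have := Finset.mem_range.1 hj
      rw [zero_pow (by omega), mul_zero]
    rw [h0] at hlim
    refine tendsto_nhds_unique ((hA J).congr' ?_) hlim
    have h2 : ∀ᶠ r : ℝ in nhdsWithin 1 (Set.Iio 1), 0 < r :=
      (lt_mem_nhds one_pos).filter_mono nhdsWithin_le_nhds
    filter_upwards [ht.eventually_gt_atTop 0, h2, self_mem_nhdsWithin] with r h3 h4 h5
    have h6 : ‖(r : ℂ) * ζ‖ < 1 := by
      rw [norm_mul, hnorm, mul_one, Complex.norm_real, Real.norm_eq_abs, abs_of_pos h4]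
      exact h5
    have h7 := h _ h6
    have hne : VV q k (r * ζ) ≠ 0 := norm_pos_iff.1 h3
    rw [Finset.sum_range_succ] at h7
    have h8 : (A J).eval ((r : ℂ) * ζ) * VV q k (r * ζ) ^ J =
      (- ∑ j ∈ Finset.range J, (A j).eval ((r : ℂ) * ζ) * (VV q k (r * ζ))⁻¹ ^ (J - j)) *
        VV q k (r * ζ) ^ J := by
      rw [eq_neg_of_add_eq_zero_right h7, neg_mul, Finset.sum_mul]
      congr 1
      refine Finset.sum_congr rfl fun j hj => ?_
      have hj' := Finset.mem_range.1 hj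
      have : VV q k (r * ζ) ^ J = VV q k (r * ζ) ^ (J - j) * VV q k (r * ζ) ^ j := by
        rw [← pow_add]; congr 1; omega
      rw [this, inv_pow]
      field_simp
    exact mul_right_cancel₀ (pow_ne_zero _ hne) h8
  have hprim : ∀ m : ℕ, IsPrimitiveRoot
      (Complex.exp (2 * Real.pi * Complex.I / (((q ^ k) ^ m * q : ℕ) : ℂ))) ((q ^ k) ^ m * q) :=
    fun m => Complex.isPrimitiveRoot_exp _ (by positivity)
  refine Polynomial.eq_zero_of_infinite_isRoot _ (Set.infinite_of_injective_forall_mem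
    (f := fun m : ℕ => Complex.exp (2 * Real.pi * Complex.I / (((q ^ k) ^ m * q : ℕ) : ℂ)))
    ?_ (fun m => key m _ (hprim m)))
  intro m n hmn
  have h1 := hprim m
  simp only at hmn
  rw [hmn] at h1
  have h2 := h1.unique (hprim n)
  exact Nat.pow_right_injective hd (Nat.eq_of_mul_eq_mul_right (by omega) h2)

lemma all_zero (q k : ℕ) (hq : 2 ≤ q) (hk : 2 ≤ k) (A : ℕ → Polynomial ℂ) (J : ℕ)
    (h : ∀ x : ℂ, ‖x‖ < 1 → ∑ j ∈ Finset.range J, (A j).eval x * VV q k x ^ j = 0) :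
    ∀ j < J, A j = 0 := by
  induction J with
  | zero => intro j hj; omega
  | succ J ih =>
    have h0 := lead_zero q k hq hk A J h
    intro j hj
    rcases Nat.lt_succ_iff_lt_or_eq.1 hj with h1 | rfl
    · refine ih (fun x hx => ?_) j h1
      have := h x hx
      rwa [Finset.sum_range_succ, h0, Polynomial.eval_zero, zero_mul, add_zero] at this
    · exact h0

/-- the two variable polynomial -/
noncomputable def EE (N : ℕ) (t : Fin (N + 1) × Fin (N + 1) → ℤ) (x y : ℂ) : ℂ :=
  ∑ p, (t p : ℂ) * x ^ p.1.val * y ^ p.2.val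

lemma EE_ne (q k : ℕ) (hq : 2 ≤ q) (hk : 2 ≤ k) (N : ℕ) (t : Fin (N + 1) × Fin (N + 1) → ℤ)
    (h : ∀ x : ℂ, ‖x‖ < 1 → EE N t x (VV q k x) = 0) : t = 0 := by
  let A : ℕ → Polynomial ℂ := fun j => if hj : j < N + 1 then
    ∑ i : Fin (N + 1), Polynomial.monomial i.val ((t (i, ⟨j, hj⟩) : ℤ) : ℂ) else 0
  have h1 := all_zero q k hq hk A (N + 1) (fun x hx => by
    rw [← h x hx, EE, Fintype.sum_prod_type_right,
      ← Fin.sum_univ_eq_sum_range (fun j => (A j).eval x * VV q k x ^ j)]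
    refine Finset.sum_congr rfl fun j _ => ?_
    simp only [A, j.isLt, dif_pos, Polynomial.eval_finsetSum, Finset.sum_mul,
      Polynomial.eval_monomial, Fin.eta])
  funext p
  obtain ⟨i, j⟩ := p
  have h2 := congrArg (fun P => Polynomial.coeff P i.val) (h1 j.val j.isLt)
  simp only [A, j.isLt, dif_pos, Polynomial.finsetSum_coeff, Polynomial.coeff_monomial,
    Polynomial.coeff_zero, Fin.eta, Fin.val_inj, Finset.sum_ite_eq', Finset.mem_univ, if_true] at h2
  simpa using h2
lemma aux_linear (M : ℕ) {β : Type} [Fintype β] [DecidableEq β] (hM : 0 < M)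
  (h : M < Fintype.card β) (f : β → PowerSeries ℤ) : ∃ t : β → ℤ, t ≠ 0 ∧ ∀ m < M,
    PowerSeries.coeff m (∑ b, PowerSeries.C (t b) * f b) = 0 := by
  obtain ⟨t, h1, h2, _⟩ := Int.Matrix.exists_ne_zero_int_vec_norm_le
    (Matrix.of fun (i : Fin M) (b : β) => PowerSeries.coeff i.val (f b)) (by simpa using h) (by simpa using hM)
  refine ⟨t, h1, fun m hm => ?_⟩
  have h3 := congrFun h2 ⟨m, hm⟩
  simp only [Matrix.mulVec, dotProduct, Matrix.of_apply, Pi.zero_apply] at h3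
  rw [map_sum, ← h3]
  refine Finset.sum_congr rfl fun b _ => ?_
  rw [PowerSeries.coeff_C_mul, mul_comm]

/-- `f` converges absolutely at `x` with value `y`. -/
def PS (f : PowerSeries ℤ) (x y : ℂ) : Prop :=
  Summable (fun n => ‖((PowerSeries.coeff n f : ℤ) : ℂ) * x ^ n‖) ∧
  HasSum (fun n => ((PowerSeries.coeff n f : ℤ) : ℂ) * x ^ n) y

lemma PS.add {f g : PowerSeries ℤ} {x y z : ℂ} (hf : PS f x y) (hg : PS g x z) :
    PS (f + g) x (y + z) := by
  have h : (fun n => ((PowerSeries.coeff n (f + g) : ℤ) : ℂ) * x ^ n) = fun n =>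
    ((PowerSeries.coeff n f : ℤ) : ℂ) * x ^ n + ((PowerSeries.coeff n g : ℤ) : ℂ) * x ^ n := by
    funext n; simp; ring
  refine ⟨?_, ?_⟩
  · have h' : (fun n => ‖_‖) = fun n => ‖_‖ := congrArg (fun F : ℕ → ℂ => fun n => ‖F n‖) h
    rw [h']
    exact Summable.of_nonneg_of_le (fun _ => norm_nonneg _) (fun n => norm_add_le _ _)
      (hf.1.add hg.1)
  · rw [h]; exact hf.2.add hg.2

lemma PS.mul {f g : PowerSeries ℤ} {x y z : ℂ} (hf : PS f x y) (hg : PS g x z) :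
    PS (f * g) x (y * z) := by
  have h : (fun n => ((PowerSeries.coeff n (f * g) : ℤ) : ℂ) * x ^ n) = fun n =>
    ∑ p ∈ Finset.HasAntidiagonal.antidiagonal n, (((PowerSeries.coeff p.1 f : ℤ) : ℂ) * x ^ p.1) *
      (((PowerSeries.coeff p.2 g : ℤ) : ℂ) * x ^ p.2) := by
    funext n
    rw [PowerSeries.coeff_mul, Int.cast_sum, Finset.sum_mul]
    refine Finset.sum_congr rfl fun p hp => ?_
    rw [← Finset.HasAntidiagonal.mem_antidiagonal.1 hp, pow_add]; push_cast; ring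
  have h1 := summable_norm_sum_mul_antidiagonal_of_summable_norm hf.1 hg.1
  refine ⟨?_, ?_⟩
  · have h' : (fun n => ‖_‖) = fun n => ‖_‖ := congrArg (fun F : ℕ → ℂ => fun n => ‖F n‖) h
    rw [h']; exact h1
  · rw [h, ← hf.2.tsum_eq, ← hg.2.tsum_eq,
      tsum_mul_tsum_eq_tsum_sum_antidiagonal_of_summable_norm hf.1 hg.1]
    exact h1.of_norm.hasSum

lemma PS.C (c : ℤ) (x : ℂ) : PS (PowerSeries.C c) x c := by
  have h : ∀ n, n ≠ 0 → ((PowerSeries.coeff n (PowerSeries.C c) : ℤ) : ℂ) * x ^ n = 0 := by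
    intro n hn; rw [PowerSeries.coeff_C, if_neg hn]; simp
  refine ⟨?_, ?_⟩
  · refine summable_of_ne_finset_zero (s := {0}) fun n hn => ?_
    rw [h n (by simpa using hn), norm_zero]
  · have := hasSum_single 0 h
    simpa using this

lemma PS.X (x : ℂ) : PS PowerSeries.X x x := by
  have h : ∀ n, n ≠ 1 → ((PowerSeries.coeff n (PowerSeries.X) : ℤ) : ℂ) * x ^ n = 0 := by
    intro n hn; simp [PowerSeries.coeff_X, hn]
  refine ⟨?_, ?_⟩
  · refine summable_of_ne_finset_zero (s := {1}) fun n hn => ?_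
    rw [h n (by simpa using hn), norm_zero]
  · have := hasSum_single 1 h
    simpa using this

lemma PS.pow {f : PowerSeries ℤ} {x y : ℂ} (hf : PS f x y) (n : ℕ) : PS (f ^ n) x (y ^ n) := by
  induction n with
  | zero => simpa using PS.C 1 x
  | succ n ih => rw [pow_succ, pow_succ]; exact ih.mul hf

lemma PS.sum {ι : Type} (s : Finset ι) {f : ι → PowerSeries ℤ} {x : ℂ} {y : ι → ℂ}
    (h : ∀ i ∈ s, PS (f i) x (y i)) : PS (∑ i ∈ s, f i) x (∑ i ∈ s, y i) := by
  classical
  induction s using Finset.induction_on with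
  | empty => simpa using PS.C 0 x
  | insert a s ha ih =>
    rw [Finset.sum_insert ha, Finset.sum_insert ha]
    exact (h a (by simp)).add (ih fun i hi => h i (by simp [hi]))

/-- bound near zero -/
lemma PS_bound (f : PowerSeries ℤ) (F : ℂ → ℂ) (hf : ∀ x, ‖x‖ < 1 → PS f x (F x)) (T : ℕ)
    (hT : ∀ m < T, PowerSeries.coeff m f = 0) (ρ : ℝ) (h0 : 0 < ρ) (h1 : ρ < 1) :
    ∃ C : ℝ, 0 < C ∧ ∀ x, ‖x‖ ≤ ρ → ‖F x - (PowerSeries.coeff T f : ℤ) * x ^ T‖ ≤ C * ‖x‖ ^ (T + 1) := by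
  have hs := (hf (ρ : ℂ) (by simpa [abs_of_pos h0] using h1)).1
  have hs' := (summable_nat_add_iff (T + 1)).2 hs
  have hs2 : Summable fun n => |((PowerSeries.coeff (n + (T + 1)) f : ℤ) : ℝ)| * ρ ^ n := by
    refine (hs'.mul_right (ρ ^ (T + 1))⁻¹).congr fun n => ?_
    simp [abs_of_pos h0, pow_add, Complex.norm_intCast]
    field_simp
  set S := ∑' n, |((PowerSeries.coeff (n + (T + 1)) f : ℤ) : ℝ)| * ρ ^ n with hS
  have hS0 : 0 ≤ S := tsum_nonneg fun n => by positivity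
  refine ⟨S + 1, by linarith, fun x hx => ?_⟩
  have hx1 := hf x (hx.trans_lt h1)
  have h2 := (hasSum_nat_add_iff' (T + 1)).2 hx1.2
  rw [Finset.sum_range_succ, Finset.sum_eq_zero, zero_add] at h2
  · have h3 : ‖F x - (PowerSeries.coeff T f : ℤ) * x ^ T‖ ≤ S * ‖x‖ ^ (T + 1) := by
      rw [← h2.tsum_eq]
      refine tsum_of_norm_bounded (hs2.hasSum.mul_right _) fun n => ?_
      rw [norm_mul, norm_pow, pow_add, Complex.norm_intCast, ← mul_assoc]
      gcongr
    refine h3.trans ?_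
    gcongr
    linarith
  · intro m hm
    rw [hT m (Finset.mem_range.1 hm)]; simp

lemma PS_bound' (f : PowerSeries ℤ) (F : ℂ → ℂ) (hf : ∀ x, ‖x‖ < 1 → PS f x (F x)) (T : ℕ)
    (hT : ∀ m < T, PowerSeries.coeff m f = 0) (ρ : ℝ) (h0 : 0 < ρ) (h1 : ρ < 1) :
    ∃ C : ℝ, 0 < C ∧ ∀ x, ‖x‖ ≤ ρ → ‖F x‖ ≤ C * ‖x‖ ^ T := by
  obtain ⟨C, hC, h⟩ := PS_bound f F hf T hT ρ h0 h1
  refine ⟨C + ‖((PowerSeries.coeff T f : ℤ) : ℂ)‖, by positivity, fun x hx => ?_⟩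
  have h2 := h x hx
  have h3 : ‖F x‖ ≤ ‖F x - (PowerSeries.coeff T f : ℤ) * x ^ T‖ +
    ‖((PowerSeries.coeff T f : ℤ) : ℂ) * x ^ T‖ := by
    simpa using norm_add_le (F x - (PowerSeries.coeff T f : ℤ) * x ^ T)
      (((PowerSeries.coeff T f : ℤ) : ℂ) * x ^ T)
  rw [norm_mul, norm_pow] at h3
  have h4 : C * ‖x‖ ^ (T + 1) ≤ C * ‖x‖ ^ T := by
    gcongr C * ?_
    exact pow_le_pow_of_le_one (norm_nonneg _) (by linarith) (by omega)
  nlinarith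

lemma PS_ne (f : PowerSeries ℤ) (F : ℂ → ℂ) (hf : ∀ x, ‖x‖ < 1 → PS f x (F x)) (hne : f ≠ 0) :
    ∃ δ : ℝ, 0 < δ ∧ ∀ x, ‖x‖ < δ → x ≠ 0 → F x ≠ 0 := by
  classical
  have hex : ∃ m, PowerSeries.coeff m f ≠ 0 := by
    by_contra! h
    exact hne (PowerSeries.ext (by simpa using h))
  obtain ⟨C, hC, h⟩ := PS_bound f F hf (Nat.find hex)
    (fun m hm => by simpa using Nat.find_min hex hm) (1 / 2) (by norm_num) (by norm_num)
  have hT := Nat.find_spec hex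
  set T := Nat.find hex
  refine ⟨min (1 / 2) (1 / C), by positivity, fun x hx hx0 hF => ?_⟩
  have h2 := h x (hx.le.trans (min_le_left _ _))
  rw [hF, zero_sub, norm_neg, norm_mul, norm_pow, Complex.norm_intCast, pow_succ] at h2
  have hx' : 0 < ‖x‖ := norm_pos_iff.2 hx0
  have h3 : (1 : ℝ) ≤ |((PowerSeries.coeff T f : ℤ) : ℝ)| := by
    exact_mod_cast Int.one_le_abs hT
  have h4 : C * ‖x‖ < 1 := by
    have := hx.trans_le (min_le_right _ _)
    rw [lt_div_iff₀ hC] at this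
    linarith
  have h5 : 0 < ‖x‖ ^ T := by positivity
  nlinarith

lemma aux_exists (q k : ℕ) (hk : 2 ≤ k) (N : ℕ) (hN : 0 < N) :
    ∃ t : Fin (N + 1) × Fin (N + 1) → ℤ, t ≠ 0 ∧ ∃ f : PowerSeries ℤ,
      (∀ m < N ^ 2, PowerSeries.coeff m f = 0) ∧
      ∀ x : ℂ, ‖x‖ < 1 → PS f x (EE N t x (VV q k x)) := by
  set g : PowerSeries ℤ := PowerSeries.mk fun n => ((vv q k n : ℕ) : ℤ) with hg
  have hgx : ∀ x : ℂ, ‖x‖ < 1 → PS g x (VV q k x) := by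
    intro x hx
    refine ⟨?_, ?_⟩
    · simpa [hg] using vv_summable q k hk x hx
    · simpa [hg] using VV_hasSum q k hk x hx
  obtain ⟨t, h1, h2⟩ := aux_linear (N ^ 2) (β := Fin (N + 1) × Fin (N + 1)) (by positivity)
    (by simp; nlinarith) (fun p => PowerSeries.X ^ p.1.val * g ^ p.2.val)
  refine ⟨t, h1, _, h2, fun x hx => ?_⟩
  unfold EE
  refine PS.sum _ fun p _ => ?_
  rw [mul_assoc]
  exact (PS.C _ _).mul (((PS.X x).pow _).mul ((hgx x hx).pow _))

lemma EE_norm_le (N : ℕ) (t : Fin (N + 1) × Fin (N + 1) → ℤ) (x y : ℂ) (Y : ℝ)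
    (hx : ‖x‖ ≤ 1) (hy : ‖y‖ ≤ Y) :
    ‖EE N t x y‖ ≤ ∑ p, |(t p : ℝ)| * Y ^ p.2.val := by
  refine (norm_sum_le _ _).trans (Finset.sum_le_sum fun p _ => ?_)
  rw [norm_mul, norm_mul, norm_pow, norm_pow, Complex.norm_intCast]
  have : ‖x‖ ^ p.1.val ≤ 1 := pow_le_one₀ (norm_nonneg _) hx
  have h2 : ‖y‖ ^ p.2.val ≤ Y ^ p.2.val := by gcongr
  have h3 : |(t p : ℝ)| * ‖x‖ ^ p.1.val ≤ |(t p : ℝ)| := mul_le_of_le_one_right (abs_nonneg _) this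
  exact mul_le_mul h3 h2 (by positivity) (by positivity)

lemma liouville_lower (β : ℂ) (hβ : IsAlgebraic ℚ β) : ∃ D : ℕ, 1 ≤ D ∧
    ∀ (N : ℕ) (t : Fin (N + 1) × Fin (N + 1) → ℤ) (A : ℝ), 0 ≤ A → ∃ C : ℝ, 0 < C ∧
    ∀ (B Q : ℕ) (u w : ℤ), 0 < B → 0 < Q → ‖((u : ℂ) / B)‖ ≤ 1 → ‖((w : ℂ) / Q)‖ ≤ A →
      EE N t ((u : ℂ) / B) (β - (w : ℂ) / Q) ≠ 0 →
      1 ≤ C * (((B : ℝ) * Q) ^ N) ^ D * ‖EE N t ((u : ℂ) / B) (β - (w : ℂ) / Q)‖ := by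
  classical
  have hint : IsIntegral ℚ β := hβ.isIntegral
  let K := IntermediateField.adjoin ℚ {β}
  have : FiniteDimensional ℚ K := IntermediateField.adjoin.finiteDimensional hint
  let g : K := IntermediateField.AdjoinSimple.gen ℚ β
  have hgβ : (algebraMap K ℂ) g = β := IntermediateField.AdjoinSimple.algebraMap_gen ℚ β
  have hgalg : IsAlgebraic ℤ g :=
    (IsFractionRing.isAlgebraic_iff ℤ ℚ K).2 (Algebra.IsAlgebraic.isAlgebraic g)
  obtain ⟨c, hc0, hc⟩ := hgalg.exists_integral_multiple
  let σ₀ : K →ₐ[ℚ] ℂ := IntermediateField.val _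
  have hσ₀ : σ₀ g = β := hgβ
  have : Nonempty (K →ₐ[ℚ] ℂ) := ⟨σ₀⟩
  refine ⟨Fintype.card (K →ₐ[ℚ] ℂ), Fintype.card_pos, fun N t A hA => ?_⟩
  set D := Fintype.card (K →ₐ[ℚ] ℂ) with hD
  set C0 : ℝ := 1 + ∑ σ : K →ₐ[ℚ] ℂ, ∑ p, |(t p : ℝ)| * (‖σ g‖ + A) ^ p.2.val with hC0
  have hC0σ : ∀ σ : K →ₐ[ℚ] ℂ, ∑ p, |(t p : ℝ)| * (‖σ g‖ + A) ^ p.2.val ≤ C0 := by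
    intro σ
    have := Finset.single_le_sum (f := fun σ : K →ₐ[ℚ] ℂ =>
      ∑ p, |(t p : ℝ)| * (‖σ g‖ + A) ^ p.2.val) (fun σ _ => by positivity) (Finset.mem_univ σ)
    linarith
  have hC0pos : 0 < C0 := by positivity
  have hcabs : 0 < |(c : ℝ)| := abs_pos.2 (by exact_mod_cast hc0)
  refine ⟨(|(c : ℝ)| ^ N) ^ D * C0 ^ (D - 1), by positivity, fun B Q u w hB hQ hx hr hne => ?_⟩
  have hBC : (B : ℂ) ≠ 0 := by exact_mod_cast hB.ne'
  have hQC : (Q : ℂ) ≠ 0 := by exact_mod_cast hQ.ne'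
  have hBK : (B : K) ≠ 0 := by exact_mod_cast hB.ne'
  have hQK : (Q : K) ≠ 0 := by exact_mod_cast hQ.ne'
  -- the integral element
  let z : K := ∑ p : Fin (N + 1) × Fin (N + 1), (t p : K) * ((u : K) ^ p.1.val * (B : K) ^ (N - p.1.val)) *
    (((Q : K) * (c * g) - c * w) ^ p.2.val * ((Q : K) * c) ^ (N - p.2.val))
  have hcg : IsIntegral ℤ ((c : K) * g) := by simpa [zsmul_eq_mul] using hc
  have iz : ∀ n : ℤ, IsIntegral ℤ (n : K) := fun n => by
    simpa using (isIntegral_algebraMap (R := ℤ) (A := K) (x := n))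
  have inn : ∀ n : ℕ, IsIntegral ℤ (n : K) := fun n => by exact_mod_cast iz n
  have hzint : IsIntegral ℤ z := by
    refine IsIntegral.sum _ fun p _ => ?_
    exact ((iz _).mul (((iz _).pow _).mul ((inn _).pow _))).mul
      (((((inn _).mul hcg).sub ((iz _).mul (iz _))).pow _).mul (((inn _).mul (iz _)).pow _))
  have hσz : ∀ σ : K →ₐ[ℚ] ℂ, σ z = ((B : ℂ) * Q * c) ^ N * EE N t ((u : ℂ) / B) (σ g - (w : ℂ) / Q) := by
    intro σ
    simp only [z, map_sum, EE, Finset.mul_sum, map_mul, map_pow, map_sub, map_natCast, map_intCast]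
    refine Finset.sum_congr rfl fun p _ => ?_
    have h1 : (B : ℂ) ^ N = (B : ℂ) ^ p.1.val * (B : ℂ) ^ (N - p.1.val) := by
      rw [← pow_add]; congr 1; omega
    have h2 : ((Q : ℂ) * c) ^ N = ((Q : ℂ) * c) ^ p.2.val * ((Q : ℂ) * c) ^ (N - p.2.val) := by
      rw [← pow_add]; congr 1; omega
    have h3 : (Q : ℂ) * (c * σ g) - c * w = ((Q : ℂ) * c) * (σ g - (w : ℂ) / Q) := by
      field_simp
    have h4 : (u : ℂ) = B * (u / B) := by field_simp
    rw [h3, mul_assoc (B : ℂ), mul_pow (B : ℂ), h1, h2]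
    conv_lhs => rw [h4]
    rw [mul_pow ((Q : ℂ) * c), mul_pow (B : ℂ)]
    ring
  have hnormz : ∀ σ : K →ₐ[ℚ] ℂ, ‖σ z‖ = ((B : ℝ) * Q) ^ N * |(c : ℝ)| ^ N *
      ‖EE N t ((u : ℂ) / B) (σ g - (w : ℂ) / Q)‖ := by
    intro σ
    rw [hσz, norm_mul, norm_pow, norm_mul, norm_mul, Complex.norm_natCast, Complex.norm_natCast,
      Complex.norm_intCast, mul_pow _ |(c : ℝ)|]
  have hz0 : z ≠ 0 := by
    intro h0
    have h1 := hσz σ₀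
    rw [h0, map_zero, hσ₀] at h1
    have : ((B : ℂ) * Q * c) ^ N ≠ 0 := pow_ne_zero _ (mul_ne_zero (mul_ne_zero hBC hQC)
      (by exact_mod_cast hc0))
    exact (mul_ne_zero this hne) h1.symm
  have hNint : IsIntegral ℤ (Algebra.norm ℚ z) := Algebra.isIntegral_norm ℚ hzint
  obtain ⟨n, hn⟩ := IsIntegrallyClosed.isIntegral_iff.1 hNint
  have hN0 : Algebra.norm ℚ z ≠ 0 := Algebra.norm_ne_zero_iff.2 hz0
  have hn0 : n ≠ 0 := by
    rintro rfl
    exact hN0 (by rw [← hn]; simp)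
  have hprod := Algebra.norm_eq_prod_embeddings ℚ ℂ z
  have h1 : (1 : ℝ) ≤ ∏ σ : K →ₐ[ℚ] ℂ, ‖σ z‖ := by
    rw [← norm_prod, ← hprod, ← hn]
    simp only [eq_intCast, map_intCast, Complex.norm_intCast]
    exact_mod_cast Int.one_le_abs hn0
  rw [← Finset.mul_prod_erase _ _ (Finset.mem_univ σ₀)] at h1
  have h2 : ∏ σ ∈ Finset.univ.erase σ₀, ‖σ z‖ ≤
      (((B : ℝ) * Q) ^ N * |(c : ℝ)| ^ N * C0) ^ (D - 1) := by
    have h3 : ∀ σ ∈ Finset.univ.erase σ₀, ‖σ z‖ ≤ ((B : ℝ) * Q) ^ N * |(c : ℝ)| ^ N * C0 := by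
      intro σ _
      rw [hnormz]
      gcongr
      exact (EE_norm_le N t _ _ (‖σ g‖ + A) hx
        ((norm_sub_le _ _).trans (by gcongr))).trans (hC0σ σ)
    calc _ ≤ ∏ σ ∈ Finset.univ.erase σ₀, ((B : ℝ) * Q) ^ N * |(c : ℝ)| ^ N * C0 :=
          Finset.prod_le_prod (fun _ _ => norm_nonneg _) h3
      _ = _ := by
          rw [Finset.prod_const, Finset.card_erase_of_mem (Finset.mem_univ _), Finset.card_univ]
  have h4 := h1.trans (mul_le_mul_of_nonneg_left h2 (norm_nonneg _))
  rw [hnormz, hσ₀] at h4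
  refine h4.trans (le_of_eq ?_)
  obtain ⟨D', hD'⟩ : ∃ D', D = D' + 1 := ⟨D - 1, by have : 0 < D := Fintype.card_pos; omega⟩
  rw [hD', Nat.add_sub_cancel]
  simp only [mul_pow, pow_succ]
  ring

lemma RR_rat (q k a b : ℕ) (hq : 2 ≤ q) (hb : 0 < b) (hab : a < b) (m : ℕ) :
    ∃ w : ℤ, ∑ i ∈ Finset.range m, RR q k (((a : ℂ) / b) ^ (q ^ k) ^ i) =
      (w : ℂ) / ((b ^ (q ^ k) ^ m - a ^ (q ^ k) ^ m : ℕ) : ℂ) := by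
  have hbC : (b : ℂ) ≠ 0 := by exact_mod_cast hb.ne'
  have hlt : ∀ e : ℕ, 0 < e → a ^ e < b ^ e := fun e he => Nat.pow_lt_pow_left hab he.ne'
  have hne : ∀ e : ℕ, 0 < e → (b : ℂ) ^ e - (a : ℂ) ^ e ≠ 0 := by
    intro e he h
    have := sub_eq_zero.1 h
    have h2 : b ^ e = a ^ e := by exact_mod_cast this
    have := hlt e he
    omega
  have hspos : ∀ i, 0 < (q ^ k) ^ i := fun i => by positivity
  have key : ∀ i ∈ Finset.range m, ∃ w : ℤ, RR q k (((a : ℂ) / b) ^ (q ^ k) ^ i) =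
      (w : ℂ) / ((b : ℂ) ^ (q ^ k) ^ m - (a : ℂ) ^ (q ^ k) ^ m) := by
    intro i hi
    have hi' := Finset.mem_range.1 hi
    set e := (q ^ k) ^ i with he
    have hdvd : e * q ^ k ∣ (q ^ k) ^ m := by
      rw [he, ← pow_succ]; exact pow_dvd_pow _ hi'
    have hd2 : (b : ℤ) ^ (e * q ^ k) - (a : ℤ) ^ (e * q ^ k) ∣
        (b : ℤ) ^ (q ^ k) ^ m - (a : ℤ) ^ (q ^ k) ^ m := by
      obtain ⟨c, hc⟩ := hdvd
      have h7 := sub_dvd_pow_sub_pow ((b : ℤ) ^ (e * q ^ k)) ((a : ℤ) ^ (e * q ^ k)) c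
      rwa [← pow_mul, ← pow_mul, ← hc] at h7
    obtain ⟨f, hf⟩ := hd2
    have hf' : (b : ℂ) ^ (q ^ k) ^ m - (a : ℂ) ^ (q ^ k) ^ m =
      ((b : ℂ) ^ (e * q ^ k) - (a : ℂ) ^ (e * q ^ k)) * f := by exact_mod_cast congrArg (Int.cast : ℤ → ℂ) hf
    refine ⟨(∑ t ∈ Finset.range (q ^ k), (vv q k t : ℤ) * (a : ℤ) ^ (e * t) *
      (b : ℤ) ^ (e * (q ^ k - t))) * f, ?_⟩
    have hmne := hne ((q ^ k) ^ m) (hspos m)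
    have hene := hne (e * q ^ k) (by positivity)
    have hden : (1 : ℂ) - (((a : ℂ) / b) ^ e) ^ (q ^ k) =
        ((b : ℂ) ^ (e * q ^ k) - (a : ℂ) ^ (e * q ^ k)) / (b : ℂ) ^ (e * q ^ k) := by
      rw [← pow_mul, div_pow]; field_simp
    have hnum : SS q k (((a : ℂ) / b) ^ e) = (∑ t ∈ Finset.range (q ^ k), (vv q k t : ℂ) *
        (a : ℂ) ^ (e * t) * (b : ℂ) ^ (e * (q ^ k - t))) / (b : ℂ) ^ (e * q ^ k) := by
      rw [SS, Finset.sum_div]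
      refine Finset.sum_congr rfl fun t ht => ?_
      have h5 : (b : ℂ) ^ (e * q ^ k) = (b : ℂ) ^ (e * t) * (b : ℂ) ^ (e * (q ^ k - t)) := by
        rw [← pow_add, ← mul_add]; congr 2
        have := Finset.mem_range.1 ht; omega
      rw [← pow_mul, div_pow, h5]
      field_simp
    have hfne : (f : ℂ) ≠ 0 := by
      intro h0; rw [h0, mul_zero] at hf'; exact hmne hf'
    rw [RR, hden, hnum, hf']
    push_cast
    have hbe : (b : ℂ) ^ (e * q ^ k) ≠ 0 := pow_ne_zero _ hbC
    rw [div_div_div_cancel_right₀ hbe, mul_div_mul_right _ _ hfne]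
  choose! w hw using key
  refine ⟨∑ i ∈ Finset.range m, w i, ?_⟩
  rw [Nat.cast_sub (hlt _ (hspos m)).le, Int.cast_sum, Finset.sum_div]
  push_cast
  exact Finset.sum_congr rfl hw

lemma VV_transc (q k a b : ℕ) (hq : 2 ≤ q) (hk : 2 ≤ k) (ha : 0 < a) (hab : a < b) :
    Transcendental ℚ (VV q k ((a : ℂ) / b)) := by
  intro halg
  have hb : 0 < b := ha.trans hab
  have hd : 2 ≤ q ^ k := hq.trans (Nat.le_self_pow (by omega) q)
  set ρ : ℝ := (a : ℝ) / b with hρ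
  have hρ0 : 0 < ρ := by positivity
  have hρ1 : ρ < 1 := by rw [hρ, div_lt_one (by positivity)]; exact_mod_cast hab
  set α : ℂ := (a : ℂ) / b with hα
  have hαn : ‖α‖ = ρ := by simp [hα, hρ]
  have hα0 : α ≠ 0 := by rw [← norm_pos_iff, hαn]; exact hρ0
  obtain ⟨D, hD, hL⟩ := liouville_lower _ halg
  -- choose N
  obtain ⟨N, hN, hθ⟩ : ∃ N : ℕ, 0 < N ∧ (b : ℝ) ^ (2 * D) * ρ ^ N < 1 := by
    have h1 : Filter.Tendsto (fun N : ℕ => (b : ℝ) ^ (2 * D) * ρ ^ N) Filter.atTop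
        (nhds ((b : ℝ) ^ (2 * D) * 0)) :=
      (tendsto_pow_atTop_nhds_zero_of_lt_one hρ0.le hρ1).const_mul _
    rw [mul_zero] at h1
    exact ((Filter.eventually_gt_atTop 0).and (h1.eventually (gt_mem_nhds one_pos))).exists
  obtain ⟨t, ht, f, hf0, hf⟩ := aux_exists q k hk N hN
  have hfne : f ≠ 0 := by
    rintro rfl
    refine ht (EE_ne q k hq hk N t fun x hx => ?_)
    have := (hf x hx).2
    simp only [map_zero, Int.cast_zero, zero_mul] at this
    exact this.unique hasSum_zero
  obtain ⟨δ, hδ, hne⟩ := PS_ne f _ hf hfne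
  obtain ⟨C1, hC1, hup⟩ := PS_bound' f _ hf (N ^ 2) hf0 ρ hρ0 hρ1
  set A : ℝ := k * (1 - ρ)⁻¹ + k * (1 - ρ)⁻¹ with hA
  have hA0 : 0 ≤ A := by
    have : 0 < 1 - ρ := by linarith
    positivity
  obtain ⟨C, hC, hlow⟩ := hL N t A hA0
  set θ : ℝ := ((b : ℝ) ^ (2 * D) * ρ ^ N) ^ N with hθdef
  have hθ0 : 0 ≤ θ := by positivity
  have hθ1 : θ < 1 := pow_lt_one₀ (by positivity) hθ hN.ne'
  have hs : Filter.Tendsto (fun m : ℕ => (q ^ k) ^ m) Filter.atTop Filter.atTop :=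
    tendsto_pow_atTop_atTop_of_one_lt (by omega)
  have e1 := ((tendsto_pow_atTop_nhds_zero_of_lt_one hρ0.le hρ1).comp hs).eventually
    (gt_mem_nhds hδ)
  have e2 : Filter.Tendsto (fun m : ℕ => C * C1 * θ ^ ((q ^ k) ^ m)) Filter.atTop
      (nhds (C * C1 * 0)) :=
    ((tendsto_pow_atTop_nhds_zero_of_lt_one hθ0 hθ1).comp hs).const_mul _
  rw [mul_zero] at e2
  obtain ⟨m, hm1, hm2⟩ := (e1.and (e2.eventually (gt_mem_nhds one_pos))).exists
  simp only [Function.comp_apply] at hm1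
  set s := (q ^ k) ^ m with hsdef
  have hspos : 0 < s := by positivity
  have hxn : ‖α ^ s‖ = ρ ^ s := by rw [norm_pow, hαn]
  have hxρ : ‖α ^ s‖ ≤ ρ := by
    rw [hxn]; exact pow_le_of_le_one hρ0.le hρ1.le hspos.ne'
  obtain ⟨w, hw⟩ := RR_rat q k a b hq hb hab m
  have hit := VV_iter q k hq hk α (by rw [hαn]; exact hρ1) m
  rw [← hsdef] at hit hw
  have hVx : VV q k (α ^ s) = VV q k α - (w : ℂ) / ((b ^ s - a ^ s : ℕ) : ℂ) := by
    rw [← hw, hit]; ring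
  have hxe : α ^ s = (((a ^ s : ℕ) : ℤ) : ℂ) / ((b ^ s : ℕ) : ℂ) := by
    rw [hα, div_pow]; push_cast; rfl
  have hEne : EE N t (α ^ s) (VV q k (α ^ s)) ≠ 0 :=
    hne _ (by rw [hxn]; exact hm1) (pow_ne_zero _ hα0)
  have hEup := hup (α ^ s) hxρ
  have hr : ‖(w : ℂ) / ((b ^ s - a ^ s : ℕ) : ℂ)‖ ≤ A := by
    have : (w : ℂ) / ((b ^ s - a ^ s : ℕ) : ℂ) = VV q k α - VV q k (α ^ s) := by
      rw [hVx]; ring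
    rw [this]
    exact (norm_sub_le _ _).trans (add_le_add (VV_bound q k hk _ ρ hαn.le hρ1)
      (VV_bound q k hk _ ρ hxρ hρ1))
  have hQ : a ^ s < b ^ s := Nat.pow_lt_pow_left hab hspos.ne'
  have hfin := hlow (b ^ s) (b ^ s - a ^ s) ((a ^ s : ℕ) : ℤ) w (by positivity) (by omega)
    (by rw [← hxe]; linarith) hr (by rw [← hxe, ← hVx]; exact hEne)
  rw [← hxe, ← hVx] at hfin
  have hQle : ((b ^ s - a ^ s : ℕ) : ℝ) ≤ (b : ℝ) ^ s := by
    have : b ^ s - a ^ s ≤ b ^ s := Nat.sub_le _ _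
    exact_mod_cast this
  have h1 : 1 ≤ C * (((b : ℝ) ^ s * (b : ℝ) ^ s) ^ N) ^ D * (C1 * (ρ ^ s) ^ N ^ 2) := by
    refine hfin.trans ?_
    rw [hxn] at hEup
    rw [Nat.cast_pow]
    gcongr
  have h2 : C * (((b : ℝ) ^ s * (b : ℝ) ^ s) ^ N) ^ D * (C1 * (ρ ^ s) ^ N ^ 2) =
      C * C1 * θ ^ s := by
    rw [hθdef]
    simp only [mul_pow, ← pow_mul]
    have : (b : ℝ) ^ (2 * D * N * s) = (b : ℝ) ^ (s * N * D) * (b : ℝ) ^ (s * N * D) := by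
      rw [← pow_add]; congr 1; ring
    rw [this, show N * N * s = s * N ^ 2 by ring]
    ring
  linarith

theorem Vqk_root_of_unity_value_transcendental (q k a b h ℓ : ℕ) (hq : 2 ≤ q) (hk : 2 ≤ k)
    (ha : 0 < a) (hb : 0 < b) (hab : Nat.Coprime a b) (hlt : (a : ℝ) / b < 1)
    (hcond : 2 * Real.log b / (Real.log b - Real.log a) < q)
    (hℓ : 1 ≤ ℓ) (hh : h ≤ q ^ ℓ - 1) :
    Transcendental ℚ (∑' n : ℕ, ((padicValNat q n % k : ℕ) : ℂ) *
      (Complex.exp (2 * Real.pi * Complex.I * h / (q : ℂ) ^ ℓ) * ((a : ℂ) / b)) ^ n) := by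
  have hltN : a < b := by
    rw [div_lt_one (by exact_mod_cast hb)] at hlt
    exact_mod_cast hlt
  set ω : ℂ := Complex.exp (2 * Real.pi * Complex.I * h / (q : ℂ) ^ ℓ) with hω
  have hqC : (q : ℂ) ≠ 0 := by
    have : q ≠ 0 := by omega
    exact_mod_cast this
  have hω1 : ω ^ (q ^ ℓ) = 1 := by
    rw [hω, ← Complex.exp_nat_mul, Complex.exp_eq_one_iff]
    refine ⟨h, ?_⟩
    push_cast
    field_simp
  have hqpos : 0 < q := by omega
  have hωn : ‖ω‖ = 1 := Complex.norm_eq_one_of_pow_eq_one hω1 (by positivity)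
  set x : ℂ := ω * ((a : ℂ) / b) with hx
  have hxn : ‖x‖ < 1 := by
    rw [hx, norm_mul, hωn, one_mul]
    simpa using hlt
  change Transcendental ℚ (VV q k x)
  have hxalg : IsAlgebraic ℚ x := by
    have h1 : IsAlgebraic ℚ ω := by
      have : IsIntegral ℚ ω := IsIntegral.of_pow (n := q ^ ℓ) (by positivity)
        (by rw [hω1]; exact isIntegral_one)
      exact this.isAlgebraic
    have h2 : IsAlgebraic ℚ ((a : ℂ) / b) := by
      rw [div_eq_mul_inv]
      exact (isAlgebraic_natCast a).mul (isAlgebraic_natCast b).inv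
    exact h1.mul h2
  rw [VV_iter q k hq hk x hxn ℓ]
  have hxs : x ^ (q ^ k) ^ ℓ = ((a ^ (q ^ k) ^ ℓ : ℕ) : ℂ) / ((b ^ (q ^ k) ^ ℓ : ℕ) : ℂ) := by
    have h1 : (q ^ k) ^ ℓ = q ^ ℓ * q ^ ((k - 1) * ℓ) := by
      rw [← pow_mul, ← pow_add]; congr 1
      obtain ⟨k', rfl⟩ : ∃ k', k = k' + 1 := ⟨k - 1, by omega⟩
      simp; ring
    have h2 : ω ^ (q ^ k) ^ ℓ = 1 := by rw [h1, pow_mul, hω1, one_pow]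
    rw [hx, mul_pow, h2, one_mul, div_pow]
    push_cast; rfl
  rw [hxs]
  have htr := VV_transc q k (a ^ (q ^ k) ^ ℓ) (b ^ (q ^ k) ^ ℓ) hq hk (by positivity)
    (Nat.pow_lt_pow_left hltN (by positivity))
  have hR : IsAlgebraic ℚ (∑ i ∈ Finset.range ℓ, RR q k (x ^ (q ^ k) ^ i)) := by
    refine (IsIntegral.sum _ fun i _ => IsAlgebraic.isIntegral ?_).isAlgebraic
    unfold RR SS
    rw [div_eq_mul_inv]
    refine IsAlgebraic.mul (IsIntegral.sum _ fun t _ => IsAlgebraic.isIntegral ?_).isAlgebraic (IsAlgebraic.inv ?_)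
    · exact (isAlgebraic_natCast _).mul ((hxalg.pow _).pow _)
    · exact isAlgebraic_one.sub ((hxalg.pow _).pow _)
  intro hsum
  refine htr ?_
  have := hsum.sub hR
  simpa using this
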